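/- Let X = K²_{m,m,m} with orientations chosen following the cyclic rule A → B → C → A. Let P↑_{3m}, P↑_{2m} be the orthogonal projections onto the eigenspaces of L↑_1(X) for eigenvalues 3m and 2m, and P↓_{3m} the projection onto the 3m-eigenspace of L↓_1(X), all extended by zero to indices in binom(V,2) ∖ X_1. Then T := 2m(P↑_{3m} + P↑_{2m} + P↓_{3m}) − L↓_1(X) satisfies: (1) T_{F,F} = 0 for all F ∈ binom(V,2); (2) T_{F,F'} = 0 whenever F ∩ F' ≠ ∅ and F ∪ F' ∉ X_2; (3) 2m·I − L↓_1 − T ⪰ 0, where L↓_1 is the down-Laplacian of the complete 2-complex. -/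

import Mathlib

open Finset Matrix

/-- The oriented incidence number `[F:K]` induced by the global linear order on
the vertices: it is `(-1)^j` if `K ⊆ F`, `F ∖ K = {x_j}` and `x_j` is the `j`-th
smallest element of `F`, and `0` otherwise. -/
def inc {V : Type} [DecidableEq V] [LinearOrder V] (F K : Finset V) : ℝ :=
  if K ⊆ F ∧ F.card = K.card + 1 then
    ∑ x ∈ F \ K, (-1 : ℝ) ^ (K.filter (fun y => y < x)).card
  else 0

/-- An abstract simplicial complex on a vertex type `V`: a family of finite subsets
of `V` closed under taking subsets. -/
structure SC (V : Type) [DecidableEq V] where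
  faces : Finset (Finset V)
  down_closed : ∀ ⦃F⦄, F ∈ faces → ∀ ⦃K : Finset V⦄, K ⊆ F → K ∈ faces

variable {V : Type} [Fintype V] [DecidableEq V] [LinearOrder V]

/-- The faces of cardinality `m` (i.e. of dimension `m-1`) of a complex. -/
def SC.dfaces (X : SC V) (m : ℕ) : Finset (Finset V) := X.faces.filter fun F => F.card = m

/-- The faces of cardinality `m`, as a type (index set of the space `C^{m-1}` of
`(m-1)`-dimensional cochains). -/
abbrev Face (X : SC V) (m : ℕ) := {F : Finset V // F ∈ X.dfaces m}

/-- The matrix of the coboundary map `δ_{m-1}` from `(m-1)`-dimensional cochains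
(functions on cardinality-`m` faces) to `m`-dimensional cochains, in the bases of
elementary cochains. -/
def deltaMat (X : SC V) (m : ℕ) : Matrix (Face X (m + 1)) (Face X m) ℝ :=
  fun H F => inc H.1 F.1

/-- The up-Laplacian `L↑_{m-1} = ∂_m δ_{m-1}` acting on `(m-1)`-dimensional cochains,
where `∂ = δ*` is the adjoint (transpose) of the coboundary map. -/
def Lup (X : SC V) (m : ℕ) : Matrix (Face X m) (Face X m) ℝ :=
  (deltaMat X m)ᵀ * deltaMat X m

/-- The down-Laplacian `L↓_m = δ_{m-1} ∂_m` acting on `m`-dimensional cochains. -/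
def Ldown (X : SC V) (m : ℕ) : Matrix (Face X (m + 1)) (Face X (m + 1)) ℝ :=
  deltaMat X m * (deltaMat X m)ᵀ

/-- The space of harmonicSp `i`-cochains `H_i = Z_i ∩ Z^i = ker ∂_i ∩ ker δ_i`. -/
def harmonicSp (X : SC V) (i : ℕ) : Submodule ℝ (Face X (i + 1) → ℝ) :=
  LinearMap.ker (Matrix.mulVecLin (deltaMat X i)ᵀ) ⊓
    LinearMap.ker (Matrix.mulVecLin (deltaMat X (i + 1)))

/-- The type of all `k`-element subsets of `V`. -/
abbrev KSet (V : Type) [Fintype V] [DecidableEq V] (k : ℕ) := {F : Finset V // F.card = k}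

/-- `ε_{F,F'} = [F : F ∩ F'] ⬝ [F' : F ∩ F']`. -/
def eps {V : Type} [DecidableEq V] [LinearOrder V] (F F' : Finset V) : ℝ :=
  inc F (F ∩ F') * inc F' (F ∩ F')

/-- The down-Laplacian `L↓_{k-1}` of the complete complex `K_n^k`, as a matrix indexed
by all `k`-subsets of the vertex set: diagonal entries `k`, off-diagonal entries
`ε_{F,F'}` (which vanish unless `|F ∩ F'| = k-1`). -/
def Lc (V : Type) [Fintype V] [DecidableEq V] [LinearOrder V] (k : ℕ) :
    Matrix (KSet V k) (KSet V k) ℝ :=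
  fun F F' => if F = F' then (k : ℝ) else eps F.1 F'.1

/-- `S` is an independent set of the pure `k`-dimensional complex `X`: it contains
no `k`-dimensional face of `X`. -/
def SC.IsIndep (X : SC V) (k : ℕ) (S : Finset V) : Prop :=
  ∀ H ∈ X.dfaces (k + 1), ¬ H ⊆ S

/-- The independence number `α(X)` of a pure `k`-dimensional complex. -/
noncomputable def alphaNum (X : SC V) (k : ℕ) : ℕ :=
  sSup {m | ∃ S : Finset V, X.IsIndep k S ∧ S.card = m}

/-- `X` is a pure `k`-dimensional simplicial complex: all faces have dimension at
most `k` and every face is contained in a face of dimension `k`. -/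
def SC.Pure (X : SC V) (k : ℕ) : Prop :=
  (∀ F ∈ X.faces, F.card ≤ k + 1) ∧ ∀ F ∈ X.faces, ∃ H ∈ X.dfaces (k + 1), F ⊆ H

/-- Feasibility for the primal semidefinite program defining `ϑ_k(X)`. -/
def thetaFeasible (X : SC V) (k : ℕ) (Y : Matrix (KSet V k) (KSet V k) ℝ) : Prop :=
  Y.PosSemidef ∧ Matrix.trace Y = 1 ∧
  (∀ F F' : KSet V k, F.1 ∪ F'.1 ∈ X.dfaces (k + 1) → Y F F' = 0) ∧
  (∀ F F' : KSet V k, k + 2 ≤ (F.1 ∪ F'.1).card → Y F F' = 0) ∧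
  (∀ F F' G G' : KSet V k, F.1 ∪ F'.1 = G.1 ∪ G'.1 →
    eps F.1 F'.1 * Y F F' = eps G.1 G'.1 * Y G G')

/-- The theta number `ϑ_k(X)` of a pure `k`-dimensional simplicial complex: the optimal
value of the semidefinite program maximizing `⟨L↓_{k-1}, Y⟩` over feasible `Y`. -/
noncomputable def theta (X : SC V) (k : ℕ) : ℝ :=
  sSup {t | ∃ Y, thetaFeasible X k Y ∧ Matrix.trace (Lc V k * Y) = t}

/-- The complete `k`-dimensional complex on the vertex type `V`: all subsets of
cardinality at most `k+1` are faces. -/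
def completeComplex (V : Type) [Fintype V] [DecidableEq V] (k : ℕ) : SC V :=
  ⟨univ.filter fun F => F.card ≤ k + 1, by
    intro F hF K hK
    simp only [mem_filter, mem_univ, true_and] at hF ⊢
    exact le_trans (card_le_card hK) hF⟩

/-- The empty complex (no faces at all), conventionally pure of any dimension. -/
def emptyComplex (V : Type) [DecidableEq V] : SC V :=
  ⟨∅, by intro F hF; simp at hF⟩

/-- The largest eigenvalue of a matrix. -/
noncomputable def lambdaMax {ι : Type} [Fintype ι] (M : Matrix ι ι ℝ) : ℝ :=
  sSup {μ : ℝ | Module.End.HasEigenvalue (Matrix.mulVecLin M) μ}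

/-- The smallest eigenvalue of a matrix. -/
noncomputable def lambdaMin {ι : Type} [Fintype ι] (M : Matrix ι ι ℝ) : ℝ :=
  sInf {μ : ℝ | Module.End.HasEigenvalue (Matrix.mulVecLin M) μ}

/-- The degree of a face `F`: the number of faces of one higher dimension containing it. -/
def SC.deg (X : SC V) (F : Finset V) : ℕ :=
  ((X.dfaces (F.card + 1)).filter fun H => F ⊆ H).card

/-- The minimal degree of a `(k-1)`-dimensional face (a face of cardinality `k`). -/
noncomputable def degMin (X : SC V) (k : ℕ) : ℕ :=
  sInf {m | ∃ F ∈ X.dfaces k, m = X.deg F}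

/-- The up-Laplacian `L↑_{k-1}(X)` extended by zeros to a matrix indexed by all
`k`-subsets of the vertex set. -/
def LupE (X : SC V) (k : ℕ) : Matrix (KSet V k) (KSet V k) ℝ :=
  fun F F' => ∑ H ∈ X.dfaces (k + 1), inc H F.1 * inc H F'.1

/-- The down-Laplacian `L↓_{k-1}(X)` extended by zeros to a matrix indexed by all
`k`-subsets of the vertex set. -/
def LdownE (X : SC V) (k : ℕ) : Matrix (KSet V k) (KSet V k) ℝ :=
  fun F F' =>
    if F.1 ∈ X.faces ∧ F'.1 ∈ X.faces then ∑ K ∈ X.dfaces (k - 1), inc F.1 K * inc F'.1 K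
    else 0

/-- The Lovász theta number of a graph given by an adjacency relation `adj` on a finite
vertex type, in its primal formulation. -/
noncomputable def thetaG {W : Type} [Fintype W] (adj : W → W → Prop) : ℝ :=
  sSup {t | ∃ Z : Matrix W W ℝ, Z.PosSemidef ∧ Matrix.trace Z = 1 ∧
    (∀ v w, adj v w → Z v w = 0) ∧ t = ∑ v, ∑ w, Z v w}

/-- The complete tripartite 2-complex `K²_{m,m,m}` on `3m` vertices: the three parts are
the fibers of `v ↦ v / m`, the 2-faces are the triangles with one vertex in each part,
and the 1-faces are the edges with at most one vertex in each part. -/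
def tripartite (m : ℕ) : SC (Fin (3 * m)) :=
  ⟨univ.filter fun F => F.card ≤ 3 ∧ ∀ v ∈ F, ∀ w ∈ F, v ≠ w → v.val / m ≠ w.val / m, by
    intro F hF K hK
    simp only [mem_filter, mem_univ, true_and] at hF ⊢
    exact ⟨le_trans (card_le_card hK) hF.1,
      fun v hv w hw hvw => hF.2 v (hK hv) w (hK hw) hvw⟩⟩

section helpers

abbrev EE (m : ℕ) := Fin 3 × Fin m × Fin m
abbrev TT (m : ℕ) := Fin m × Fin m × Fin m

def vx {m : ℕ} (p : Fin 3) (a : Fin m) : Fin (3 * m) := finProdFinEquiv (p, a)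

lemma vx_inj {m : ℕ} {p q : Fin 3} {a b : Fin m} : vx p a = vx q b ↔ p = q ∧ a = b := by
  simp [vx]

lemma vx_val {m : ℕ} (p : Fin 3) (a : Fin m) : (vx p a).val = a.val + m * p.val := rfl

lemma vx_surj {m : ℕ} (v : Fin (3 * m)) : ∃ p a, v = vx (m := m) p a := by
  obtain ⟨⟨p, a⟩, h⟩ := finProdFinEquiv.surjective v
  exact ⟨p, a, h.symm⟩

lemma vx_part {m : ℕ} (p : Fin 3) (a : Fin m) : (vx p a).val / m = p.val := by
  have : 0 < m := a.pos
  rw [vx_val, Nat.add_mul_div_left _ _ this, Nat.div_eq_of_lt a.2, zero_add]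

lemma vx_lt {m : ℕ} {p q : Fin 3} (h : p < q) (a b : Fin m) : vx p a < vx q b := by
  rw [Fin.lt_def, vx_val, vx_val]
  have h1 : p.val + 1 ≤ q.val := h
  have := Nat.mul_le_mul_left m h1
  have := a.2
  nlinarith

def edge {m : ℕ} (e : EE m) : Finset (Fin (3 * m)) := {vx e.1 e.2.1, vx (e.1 + 1) e.2.2}

def tri {m : ℕ} (t : TT m) : Finset (Fin (3 * m)) := {vx 0 t.1, vx 1 t.2.1, vx 2 t.2.2}

lemma edge_card {m : ℕ} (e : EE m) : (edge e).card = 2 := by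
  apply card_pair
  rw [Ne, vx_inj]
  rintro ⟨h, -⟩
  revert h
  generalize e.1 = p
  revert p; decide

def sg (p : Fin 3) : ℝ := if p = 2 then -1 else 1

lemma sg_sq (p : Fin 3) : sg p * sg p = 1 := by
  unfold sg; split_ifs <;> norm_num

lemma pair_eq {α : Type} [DecidableEq α] {a b c d : α} (h : ({a, b} : Finset α) = {c, d}) :
    (a = c ∧ b = d) ∨ (a = d ∧ b = c) := by
  have h' : ({a, b} : Set α) = {c, d} := by
    have := congrArg (fun s : Finset α => (s : Set α)) h
    simpa using this
  exact Set.pair_eq_pair_iff.1 h'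

lemma edge_inj {m : ℕ} {e e' : EE m} (h : edge e = edge e') : e = e' := by
  obtain ⟨p, a, b⟩ := e
  obtain ⟨p', a', b'⟩ := e'
  rcases pair_eq h with ⟨h1, h2⟩ | ⟨h1, h2⟩
  · rw [vx_inj] at h1 h2
    simp_all
  · rw [vx_inj] at h1 h2
    exfalso
    have h3 := h1.1
    have h4 := h2.1
    simp only at h3 h4
    revert h3 h4
    clear h h1 h2
    revert p p'
    decide

lemma edge_swap {m : ℕ} (p : Fin 3) (a b : Fin m) (q : Fin 3) (h : p ≠ q) :
    ∃ e : EE m, ({vx p a, vx q b} : Finset (Fin (3 * m))) = edge e := by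
  have : q = p + 1 ∨ p = q + 1 := by revert p q; decide
  rcases this with rfl | rfl
  · exact ⟨(p, a, b), rfl⟩
  · exact ⟨(q, b, a), by rw [Finset.pair_comm]; rfl⟩

lemma mem_faces {m : ℕ} (F : KSet (Fin (3 * m)) 2) :
    F.1 ∈ (tripartite m).faces ↔ ∃ e : EE m, F.1 = edge e := by
  obtain ⟨F, hF⟩ := F
  simp only [tripartite, mem_filter, mem_univ, true_and]
  constructor
  · rintro ⟨-, h⟩
    obtain ⟨u, v, huv, rfl⟩ := Finset.card_eq_two.1 hF
    have := h u (by simp) v (by simp) huv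
    obtain ⟨p, a, rfl⟩ := vx_surj u
    obtain ⟨q, b, rfl⟩ := vx_surj v
    rw [vx_part, vx_part] at this
    exact edge_swap _ _ _ _ (fun h => this (by rw [h]))
  · rintro ⟨⟨p, a, b⟩, rfl⟩
    refine ⟨by rw [edge_card]; norm_num, ?_⟩
    have hp : p.val ≠ (p + 1).val := by clear hF; revert p; decide
    intro v hv w hw hvw
    simp only [edge, mem_insert, mem_singleton] at hv hw
    rcases hv with rfl | rfl <;> rcases hw with rfl | rfl <;> simp only [vx_part]
    · exact absurd rfl hvw
    · exact hp
    · exact hp.symm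
    · exact absurd rfl hvw

lemma tri_card {m : ℕ} (t : TT m) : (tri t).card = 3 := by
  apply Finset.card_eq_three.2
  exact ⟨_, _, _, by simp [vx_inj], by simp [vx_inj], by simp [vx_inj], rfl⟩

lemma tri_mem {m : ℕ} (t : TT m) : tri t ∈ (tripartite m).dfaces 3 := by
  simp only [SC.dfaces, tripartite, mem_filter, mem_univ, true_and]
  refine ⟨⟨by rw [tri_card], ?_⟩, tri_card t⟩
  intro v hv w hw hvw
  simp only [tri, mem_insert, mem_singleton] at hv hw
  rcases hv with rfl | rfl | rfl <;> rcases hw with rfl | rfl | rfl <;> simp only [vx_part] <;>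
    first | (exact absurd rfl hvw) | decide

lemma tri_inj {m : ℕ} {t t' : TT m} (h : tri t = tri t') : t = t' := by
  obtain ⟨x, y, z⟩ := t
  obtain ⟨x', y', z'⟩ := t'
  have h0 : vx 0 x ∈ tri (x', y', z') := by rw [← h]; simp [tri]
  have h1 : vx 1 y ∈ tri (x', y', z') := by rw [← h]; simp [tri]
  have h2 : vx 2 z ∈ tri (x', y', z') := by rw [← h]; simp [tri]
  simp [tri, vx_inj] at h0 h1 h2
  simp_all

lemma dfaces_three (m : ℕ) : (tripartite m).dfaces 3 = univ.image (tri (m := m)) := by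
  ext H
  simp only [mem_image, mem_univ, true_and]
  constructor
  · intro hH
    simp only [SC.dfaces, tripartite, mem_filter, mem_univ, true_and] at hH
    obtain ⟨⟨-, h⟩, hc⟩ := hH
    obtain ⟨u, v, w, huv, huw, hvw, rfl⟩ := Finset.card_eq_three.1 hc
    have h1 := h u (by simp) v (by simp) huv
    have h2 := h u (by simp) w (by simp) huw
    have h3 := h v (by simp) w (by simp) hvw
    obtain ⟨p, a, rfl⟩ := vx_surj u
    obtain ⟨q, b, rfl⟩ := vx_surj v
    obtain ⟨r, c, rfl⟩ := vx_surj w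
    simp only [vx_part] at h1 h2 h3
    clear h hc huv huw hvw
    fin_cases p <;> fin_cases q <;> fin_cases r <;> simp at h1 h2 h3
    · exact ⟨(a, b, c), by ext; simp [tri]⟩
    · exact ⟨(a, c, b), by ext; simp [tri]; tauto⟩
    · exact ⟨(b, a, c), by ext; simp [tri]; tauto⟩
    · exact ⟨(c, a, b), by ext; simp [tri]; tauto⟩
    · exact ⟨(b, c, a), by ext; simp [tri]; tauto⟩
    · exact ⟨(c, b, a), by ext; simp [tri]; tauto⟩
  · rintro ⟨t, rfl⟩
    exact tri_mem t

lemma inc_pair {n : ℕ} {u w : Fin n} (h : u < w) (v : Fin n) :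
    inc ({u, w} : Finset (Fin n)) {v} = (if v = w then 1 else 0) - (if v = u then 1 else 0) := by
  unfold inc
  have hc : ({u, w} : Finset (Fin n)).card = 2 := card_pair h.ne
  by_cases h1 : v = w
  · subst h1
    have : ({u, v} : Finset (Fin n)) \ {v} = {u} := by
      ext x; simp; constructor
      · tauto
      · rintro rfl; exact ⟨Or.inl rfl, h.ne⟩
    simp [hc, this, h.ne', filter_singleton, not_lt.2 h.le]
  · by_cases h2 : v = u
    · subst h2
      have : ({v, w} : Finset (Fin n)) \ {v} = {w} := by
        ext x; simp; constructor
        · tauto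
        · rintro rfl; exact ⟨Or.inr rfl, h.ne'⟩
      simp [hc, this, h.ne, filter_singleton, h]
    · simp [h1, h2]

lemma inc_triple {n : ℕ} {a b c : Fin n} (h : a < b) (h' : b < c) (F : Finset (Fin n))
    (hF : F.card = 2) :
    inc ({a, b, c} : Finset (Fin n)) F =
      (if F = {a, b} then 1 else 0) + (if F = {b, c} then 1 else 0)
        - (if F = {a, c} then 1 else 0) := by
  have hac := h.trans h'
  have hc : ({a, b, c} : Finset (Fin n)).card = 3 :=
    Finset.card_eq_three.2 ⟨a, b, c, h.ne, hac.ne, h'.ne, rfl⟩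
  have e1 : ({a, b} : Finset (Fin n)) ≠ {b, c} := fun e => by
    rcases pair_eq e with e | e <;> omega
  have e2 : ({a, b} : Finset (Fin n)) ≠ {a, c} := fun e => by
    rcases pair_eq e with e | e <;> omega
  have e3 : ({b, c} : Finset (Fin n)) ≠ {a, c} := fun e => by
    rcases pair_eq e with e | e <;> omega
  unfold inc
  by_cases hs : F ⊆ {a, b, c}
  · rw [if_pos ⟨hs, by rw [hc, hF]⟩]
    obtain ⟨u, v, huv, rfl⟩ := Finset.card_eq_two.1 hF
    have key : ({u, v} : Finset (Fin n)) = {a, b} ∨ ({u, v} : Finset (Fin n)) = {b, c} ∨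
        ({u, v} : Finset (Fin n)) = {a, c} := by
      have hu : u ∈ ({a, b, c} : Finset (Fin n)) := hs (by simp)
      have hv : v ∈ ({a, b, c} : Finset (Fin n)) := hs (by simp)
      simp only [mem_insert, mem_singleton] at hu hv
      rcases hu with rfl | rfl | rfl <;> rcases hv with rfl | rfl | rfl <;>
        simp_all [Finset.pair_comm]
    rcases key with k | k | k <;> rw [k]
    · have : ({a, b, c} : Finset (Fin n)) \ {a, b} = {c} := by
        ext x; simp; omega
      simp [this, e1, e2, filter_insert, filter_singleton, h', hac, h.ne]
    · have : ({a, b, c} : Finset (Fin n)) \ {b, c} = {a} := by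
        ext x; simp; omega
      simp [this, e1.symm, e3, filter_insert, filter_singleton, not_lt.2 h.le, not_lt.2 hac.le]
    · have : ({a, b, c} : Finset (Fin n)) \ {a, c} = {b} := by
        ext x; simp; omega
      simp [this, e2.symm, e3.symm, filter_insert, filter_singleton, h, not_lt.2 h'.le]
  · rw [if_neg (fun e => hs e.1)]
    have k1 : F ≠ {a, b} := by
      rintro rfl; apply hs; intro x; simp; tauto
    have k2 : F ≠ {b, c} := by
      rintro rfl; apply hs; intro x; simp; tauto
    have k3 : F ≠ {a, c} := by
      rintro rfl; apply hs; intro x; simp; tauto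
    simp [k1, k2, k3]

def Phi (m : ℕ) : Matrix (KSet (Fin (3 * m)) 2) (EE m) ℝ :=
  fun F e => if F.1 = edge e then sg e.1 else 0

def dd (m : ℕ) : Matrix (TT m) (EE m) ℝ := fun t e =>
  (if e = (0, t.1, t.2.1) then 1 else 0) + (if e = (1, t.2.1, t.2.2) then 1 else 0)
    + (if e = (2, t.2.2, t.1) then 1 else 0)

def d1 (m : ℕ) : Matrix (EE m) (Fin (3 * m)) ℝ := fun e v =>
  (if v = vx (e.1 + 1) e.2.2 then 1 else 0) - (if v = vx e.1 e.2.1 then 1 else 0)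

def DD (m : ℕ) : Matrix (KSet (Fin (3 * m)) 2) (Fin (3 * m)) ℝ := fun F v => inc F.1 {v}

def GG (m : ℕ) : Matrix (Fin (3 * m)) (Fin 3) ℝ := fun v p => if v.val / m = p.val then 1 else 0

lemma sum_Phi {m : ℕ} (F : KSet (Fin (3 * m)) 2) (e : EE m) (h : F.1 = edge e) (f : EE m → ℝ) :
    ∑ e', Phi m F e' * f e' = sg e.1 * f e := by
  rw [Finset.sum_eq_single e]
  · simp [Phi, h]
  · intro e' _ hne
    have : F.1 ≠ edge e' := fun h' => hne (edge_inj (h'.symm.trans h))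
    simp [Phi, this]
  · simp

lemma Phi_zero {m : ℕ} (F : KSet (Fin (3 * m)) 2) (h : F.1 ∉ (tripartite m).faces) (e : EE m) :
    Phi m F e = 0 := by
  have : F.1 ≠ edge e := fun h' => h ((mem_faces F).2 ⟨e, h'⟩)
  simp [Phi, this]

lemma PhiT_mul {m : ℕ} (f : KSet (Fin (3 * m)) 2 → ℝ) (e : EE m) :
    ∑ F, Phi m F e * f F = sg e.1 * f ⟨edge e, edge_card e⟩ := by
  rw [Finset.sum_eq_single ⟨edge e, edge_card e⟩]
  · simp [Phi]
  · intro F _ hne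
    have : F.1 ≠ edge e := fun h' => hne (Subtype.ext h')
    simp [Phi, this]
  · simp

lemma PhiT_Phi (m : ℕ) : (Phi m)ᵀ * Phi m = 1 := by
  ext e e'
  rw [Matrix.mul_apply]
  simp only [transpose_apply]
  rw [PhiT_mul (fun F => Phi m F e')]
  by_cases h : e = e'
  · subst h
    simp [Phi, sg_sq]
  · have : edge e ≠ edge e' := fun h' => h (edge_inj h')
    simp [Phi, this, h]

lemma Phi_PhiT (m : ℕ) : Phi m * (Phi m)ᵀ =
    Matrix.diagonal (fun F => if F.1 ∈ (tripartite m).faces then (1 : ℝ) else 0) := by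
  ext F F'
  rw [Matrix.mul_apply]
  simp only [transpose_apply]
  by_cases h : F.1 ∈ (tripartite m).faces
  · obtain ⟨e, he⟩ := (mem_faces F).1 h
    rw [sum_Phi F e he (fun e => Phi m F' e), Matrix.diagonal_apply, if_pos h]
    by_cases h' : F = F'
    · subst h'
      simp [Phi, he, sg_sq]
    · have : F'.1 ≠ edge e := fun h'' => h' (Subtype.ext (he.trans h''.symm))
      simp [Phi, this, h']
  · simp [Phi_zero F h, Matrix.diagonal_apply, h]

lemma inc_edge {m : ℕ} (e : EE m) (v : Fin (3 * m)) : inc (edge e) {v} = sg e.1 * d1 m e v := by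
  obtain ⟨p, a, b⟩ := e
  fin_cases p
  · simp only [edge, d1, sg]
    rw [inc_pair (vx_lt (by decide) _ _)]
    simp
  · simp only [edge, d1, sg]
    rw [inc_pair (vx_lt (by decide) _ _)]
    simp
  · simp only [edge, d1, sg]
    rw [Finset.pair_comm, inc_pair (vx_lt (by decide) _ _)]
    simp

lemma PhiT_D (m : ℕ) : (Phi m)ᵀ * DD m = d1 m := by
  ext e v
  rw [Matrix.mul_apply]
  simp only [transpose_apply]
  rw [PhiT_mul (fun F => DD m F v)]
  simp only [DD, inc_edge]
  rw [← mul_assoc, sg_sq, one_mul]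

lemma inc_tri {m : ℕ} (t : TT m) (F : KSet (Fin (3 * m)) 2) :
    inc (tri t) F.1 = ∑ e, Phi m F e * dd m t e := by
  rw [tri, inc_triple (vx_lt (by decide) _ _) (vx_lt (by decide) _ _) F.1 F.2]
  simp only [dd, mul_add, mul_ite, mul_one, mul_zero, Finset.sum_add_distrib, Finset.sum_ite_eq',
    Finset.mem_univ, if_true]
  have h : ({vx 0 t.1, vx 2 t.2.2} : Finset (Fin (3 * m))) = {vx 2 t.2.2, vx 0 t.1} :=
    Finset.pair_comm _ _
  rw [h]
  simp only [Phi, edge, sg]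
  simp
  split_ifs <;> norm_num

lemma LupE_eq (m : ℕ) : LupE (tripartite m) 2 = Phi m * ((dd m)ᵀ * dd m) * (Phi m)ᵀ := by
  ext F F'
  have : Phi m * ((dd m)ᵀ * dd m) * (Phi m)ᵀ = (Phi m * (dd m)ᵀ) * (Phi m * (dd m)ᵀ)ᵀ := by
    rw [Matrix.transpose_mul, Matrix.transpose_transpose]; simp only [Matrix.mul_assoc]
  rw [this, Matrix.mul_apply]
  simp only [LupE, Nat.reduceAdd]
  rw [dfaces_three, Finset.sum_image (fun t _ t' _ h => tri_inj h)]
  apply Finset.sum_congr rfl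
  intro t _
  rw [inc_tri, inc_tri]
  simp [Matrix.mul_apply]

lemma sum_singles {m : ℕ} (f : Finset (Fin (3 * m)) → ℝ) :
    ∑ K ∈ (tripartite m).dfaces 1, f K = ∑ v, f {v} := by
  have : (tripartite m).dfaces 1 = univ.image (fun v : Fin (3 * m) => ({v} : Finset _)) := by
    ext K
    simp only [SC.dfaces, tripartite, mem_filter, mem_univ, true_and, mem_image]
    constructor
    · rintro ⟨-, h⟩
      obtain ⟨v, rfl⟩ := Finset.card_eq_one.1 h
      exact ⟨v, rfl⟩
    · rintro ⟨v, rfl⟩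
      simp
  rw [this, Finset.sum_image (fun a _ b _ h => Finset.singleton_injective h)]

lemma LdownE_eq' (m : ℕ) : LdownE (tripartite m) 2 =
    (Phi m * (Phi m)ᵀ) * (DD m * (DD m)ᵀ) * (Phi m * (Phi m)ᵀ) := by
  rw [Phi_PhiT]
  ext F F'
  rw [Matrix.mul_diagonal, Matrix.diagonal_mul, Matrix.mul_apply]
  simp only [LdownE]
  rw [show 2 - 1 = 1 from rfl, sum_singles (fun K => inc F.1 K * inc F'.1 K)]
  simp only [DD, transpose_apply]
  split_ifs <;> simp_all

lemma LdownE_eq (m : ℕ) : LdownE (tripartite m) 2 = Phi m * (d1 m * (d1 m)ᵀ) * (Phi m)ᵀ := by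
  rw [LdownE_eq', ← PhiT_D, Matrix.transpose_mul, Matrix.transpose_transpose]
  simp only [Matrix.mul_assoc]

lemma DD_pair {n : ℕ} {u w : Fin n} (h : u ≠ w) :
    ∑ v, inc ({u, w} : Finset (Fin n)) {v} = 0 ∧
      inc ({u, w} : Finset (Fin n)) {u} * inc ({u, w} : Finset (Fin n)) {w} = -1 ∧
      inc ({u, w} : Finset (Fin n)) {u} * inc ({u, w} : Finset (Fin n)) {u} = 1 ∧
      inc ({u, w} : Finset (Fin n)) {w} * inc ({u, w} : Finset (Fin n)) {w} = 1 := by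
  rcases lt_or_gt_of_ne h with h' | h'
  · simp only [inc_pair h']
    simp [h, h.symm]
  · rw [Finset.pair_comm]
    simp only [inc_pair h']
    simp [h, h.symm]

lemma inc_not_mem {n : ℕ} (F : Finset (Fin n)) (v : Fin n) (h : v ∉ F) : inc F {v} = 0 := by
  simp [inc, h]

lemma Lc_eq (m : ℕ) : Lc (Fin (3 * m)) 2 = DD m * (DD m)ᵀ := by
  ext F F'
  rw [Matrix.mul_apply]
  simp only [DD, transpose_apply, Lc]
  split_ifs with h
  · subst h
    obtain ⟨F, hF⟩ := F
    obtain ⟨u, w, huw, rfl⟩ := Finset.card_eq_two.1 hF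
    rw [← Finset.sum_subset (Finset.subset_univ {u, w})]
    · rw [Finset.sum_pair huw]
      obtain ⟨-, -, h1, h2⟩ := DD_pair huw
      simp only [h1, h2]; norm_num
    · intro x _ hx
      simp only [inc_not_mem _ _ hx]; simp
  · have hne : F.1 ≠ F'.1 := fun h' => h (Subtype.ext h')
    unfold eps
    have hsub : ∀ v, v ∉ F.1 ∩ F'.1 → inc F.1 {v} * inc F'.1 {v} = 0 := by
      intro v hv
      simp only [mem_inter, not_and_or] at hv
      rcases hv with hv | hv <;> simp [inc_not_mem _ _ hv]
    rw [← Finset.sum_subset (Finset.subset_univ (F.1 ∩ F'.1)) (fun x _ hx => hsub x hx)]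
    have hle : (F.1 ∩ F'.1).card < 2 := by
      by_contra hcon
      push Not at hcon
      have h1 : F.1 ∩ F'.1 = F.1 := Finset.eq_of_subset_of_card_le inter_subset_left (by rw [F.2]; exact hcon)
      have h2 : F.1 ∩ F'.1 = F'.1 := Finset.eq_of_subset_of_card_le inter_subset_right (by rw [F'.2]; exact hcon)
      exact hne (h1.symm.trans h2)
    interval_cases hc : (F.1 ∩ F'.1).card
    · rw [Finset.card_eq_zero.1 hc]
      simp [inc, F.2]
    · obtain ⟨v, hv⟩ := Finset.card_eq_one.1 hc
      rw [hv]; simp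

lemma DtD_off (m : ℕ) {v w : Fin (3 * m)} (h : v ≠ w) : ((DD m)ᵀ * DD m) v w = -1 := by
  rw [Matrix.mul_apply]
  simp only [DD, transpose_apply]
  rw [Finset.sum_eq_single ⟨{v, w}, card_pair h⟩]
  · exact (DD_pair h).2.1
  · intro F _ hF
    have : v ∉ F.1 ∨ w ∉ F.1 := by
      by_contra hcon
      push Not at hcon
      apply hF
      apply Subtype.ext
      refine (Finset.eq_of_subset_of_card_le ?_ ?_).symm
      · intro x hx
        simp only [mem_insert, mem_singleton] at hx
        rcases hx with rfl | rfl
        exacts [hcon.1, hcon.2]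
      · rw [F.2, card_pair h]
    rcases this with h' | h' <;> simp [inc_not_mem _ _ h']
  · simp

lemma DD_row (m : ℕ) (F : KSet (Fin (3 * m)) 2) : ∑ v, DD m F v = 0 := by
  obtain ⟨F, hF⟩ := F
  obtain ⟨u, w, huw, rfl⟩ := Finset.card_eq_two.1 hF
  exact (DD_pair huw).1

lemma DtD (m : ℕ) : (DD m)ᵀ * DD m = (3 * (m : ℝ)) • 1 - Matrix.of (fun _ _ => 1) := by
  have hrow : ∀ v, ∑ w, ((DD m)ᵀ * DD m) v w = 0 := by
    intro v
    simp only [Matrix.mul_apply, transpose_apply]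
    rw [Finset.sum_comm]
    simp only [← Finset.mul_sum, DD_row]
    simp
  ext v w
  by_cases h : v = w
  · subst h
    have := hrow v
    rw [← Finset.add_sum_erase _ _ (mem_univ v),
      Finset.sum_congr rfl (fun w hw => DtD_off m (Finset.ne_of_mem_erase hw).symm)] at this
    simp [Finset.card_erase_of_mem] at this
    have hpos : 1 ≤ 3 * m := Nat.one_le_iff_ne_zero.2 (fun h0 => by
      have := v.2; omega)
    rw [Nat.cast_sub hpos] at this
    push_cast at this
    simp
    linarith
  · rw [DtD_off m h]
    simp [h]

lemma innerDG (m : ℕ) : (1 - Phi m * (Phi m)ᵀ) * (DD m * GG m) = 0 := by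
  ext F p
  rw [Matrix.sub_mul, Phi_PhiT, Matrix.one_mul, Matrix.sub_apply, Matrix.diagonal_mul]
  split_ifs with h
  · simp
  · rw [zero_mul, sub_zero, Matrix.mul_apply]
    obtain ⟨F, hF⟩ := F
    obtain ⟨u, w, huw, rfl⟩ := Finset.card_eq_two.1 hF
    obtain ⟨q, a, rfl⟩ := vx_surj u
    obtain ⟨r, b, rfl⟩ := vx_surj w
    have hqr : q = r := by
      by_contra hne
      exact h ((mem_faces _).2 (edge_swap _ _ _ _ hne))
    subst hqr
    have : ∀ v, DD m ⟨{vx q a, vx q b}, hF⟩ v * GG m v p =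
        DD m ⟨{vx q a, vx q b}, hF⟩ v * (if q = p then 1 else 0) := by
      intro v
      by_cases hv : v ∈ ({vx q a, vx q b} : Finset (Fin (3 * m)))
      · congr 1
        simp only [mem_insert, mem_singleton] at hv
        rcases hv with rfl | rfl <;> simp [GG, vx_part, Fin.ext_iff]
      · simp [DD, inc_not_mem _ _ hv]
    simp only [this, ← Finset.sum_mul, DD_row, zero_mul]
    rfl

set_option linter.unusedSimpArgs false

lemma sum_vx {m : ℕ} (f : Fin (3 * m) → ℝ) : ∑ v, f v = ∑ p : Fin 3, ∑ a : Fin m, f (vx p a) := by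
  rw [← finProdFinEquiv.sum_comp, Fintype.sum_prod_type]
  rfl

lemma fin3_a (p : Fin 3) : p + 1 + 1 = p + 2 := by revert p; decide
lemma fin3_b (p : Fin 3) : p + 1 + 2 = p := by revert p; decide
lemma fin3_c (p : Fin 3) : p + 2 + 1 = p := by revert p; decide
lemma fin3_d (p : Fin 3) : p + 2 + 2 = p + 1 := by revert p; decide
lemma fin3_e (p q : Fin 3) : q = p + 1 ↔ p = q + 2 := by revert p q; decide
lemma fin3_f (p : Fin 3) : p + 1 ≠ p := by revert p; decide
lemma fin3_sum (p : Fin 3) (f : Fin 3 → ℝ) : ∑ q, f q = f p + f (p + 1) + f (p + 2) := by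
  rw [Fin.sum_univ_three]
  fin_cases p
  · simp
  · simp; ring
  · simp; ring

lemma dd_mulVec {m : ℕ} (f : EE m → ℝ) (x y z : Fin m) :
    (dd m *ᵥ f) (x, y, z) = f (0, x, y) + f (1, y, z) + f (2, z, x) := by
  simp [Matrix.mulVec, dotProduct, dd, add_mul, Finset.sum_add_distrib]

lemma ddT_mulVec {m : ℕ} (g : TT m → ℝ) (e : EE m) :
    ((dd m)ᵀ *ᵥ g) e = ∑ x, ∑ y, ∑ z, dd m (x, y, z) e * g (x, y, z) := by
  simp [Matrix.mulVec, dotProduct, Fintype.sum_prod_type]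

lemma Lu_apply {m : ℕ} (f : EE m → ℝ) (p : Fin 3) (a b : Fin m) :
    (((dd m)ᵀ * dd m) *ᵥ f) (p, a, b) =
      m * f (p, a, b) + ∑ c, f (p + 1, b, c) + ∑ c, f (p + 2, c, a) := by
  rw [← Matrix.mulVec_mulVec, ddT_mulVec]
  simp only [dd_mulVec]
  fin_cases p
  · simp [dd, ite_and, Finset.sum_add_distrib]
  · simp [dd, ite_and, Finset.sum_add_distrib]
    ring
  · simp [dd, ite_and, Finset.sum_add_distrib]
    ring

lemma dd_d1 (m : ℕ) : dd m * d1 m = 0 := by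
  ext ⟨x, y, z⟩ v
  rw [Matrix.mul_apply]
  simp [dd, d1, add_mul, Finset.sum_add_distrib, show (1 + 1 : Fin 3) = 2 from rfl,
    show (2 + 1 : Fin 3) = 0 from rfl]

lemma d1T_mulVec {m : ℕ} (f : EE m → ℝ) (p : Fin 3) (a : Fin m) :
    ((d1 m)ᵀ *ᵥ f) (vx p a) = ∑ c, f (p + 2, c, a) - ∑ c, f (p, a, c) := by
  simp only [Matrix.mulVec, dotProduct, transpose_apply, d1, vx_inj, Fintype.sum_prod_type]
  simp only [sub_mul, Finset.sum_sub_distrib, ite_and, fin3_e]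
  congr 1
  · rw [Finset.sum_eq_single (p + 2)]
    · simp
    · intro q _ hq
      simp [hq]
    · simp
  · rw [Finset.sum_eq_single p]
    · simp
    · intro q _ hq
      simp [hq.symm]
    · simp

lemma d1_mulVec {m : ℕ} (g : Fin (3 * m) → ℝ) (p : Fin 3) (a b : Fin m) :
    (d1 m *ᵥ g) (p, a, b) = g (vx (p + 1) b) - g (vx p a) := by
  simp [Matrix.mulVec, dotProduct, d1, sub_mul, Finset.sum_sub_distrib]

def YY (m : ℕ) : Matrix (EE m) (Fin (3 * m)) ℝ := fun e v =>
  (if v = vx (e.1 + 1) e.2.2 then 1 else 0) + (if v = vx e.1 e.2.1 then 1 else 0)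

lemma YT_mulVec {m : ℕ} (f : EE m → ℝ) (p : Fin 3) (a : Fin m) :
    ((YY m)ᵀ *ᵥ f) (vx p a) = ∑ c, f (p + 2, c, a) + ∑ c, f (p, a, c) := by
  simp only [Matrix.mulVec, dotProduct, transpose_apply, YY, vx_inj, Fintype.sum_prod_type]
  simp only [add_mul, Finset.sum_add_distrib, ite_and, fin3_e]
  congr 1
  · rw [Finset.sum_eq_single (p + 2)]
    · simp
    · intro q _ hq
      simp [hq]
    · simp
  · rw [Finset.sum_eq_single p]
    · simp
    · intro q _ hq
      simp [hq.symm]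
    · simp

lemma Y_mulVec {m : ℕ} (g : Fin (3 * m) → ℝ) (p : Fin 3) (a b : Fin m) :
    (YY m *ᵥ g) (p, a, b) = g (vx (p + 1) b) + g (vx p a) := by
  simp [Matrix.mulVec, dotProduct, YY, add_mul, Finset.sum_add_distrib]

noncomputable def Q3u (m : ℕ) : Matrix (EE m) (EE m) ℝ := fun _ _ => 1 / (3 * (m : ℝ) ^ 2)

noncomputable def Q3d (m : ℕ) : Matrix (EE m) (EE m) ℝ := fun e e' =>
  ((if e.1 = e'.1 then 1 else 0) - 1 / 3) / (m : ℝ) ^ 2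

noncomputable def Q2u (m : ℕ) : Matrix (EE m) (EE m) ℝ := fun e e' =>
  ((YY m * (YY m)ᵀ) e e' - (1 + (if e.1 = e'.1 then 1 else 0)) / (m : ℝ)) / (2 * (m : ℝ))

/-- total over a type -/
def tau {m : ℕ} (f : EE m → ℝ) (p : Fin 3) : ℝ := ∑ a, ∑ b, f (p, a, b)

lemma tau_swap {m : ℕ} (f : EE m → ℝ) (p : Fin 3) : ∑ b, ∑ a, f (p, a, b) = tau f p :=
  Finset.sum_comm

lemma Q3u_apply {m : ℕ} (f : EE m → ℝ) (p : Fin 3) (a b : Fin m) :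
    (Q3u m *ᵥ f) (p, a, b) = (tau f p + tau f (p + 1) + tau f (p + 2)) / (3 * (m : ℝ) ^ 2) := by
  simp only [Matrix.mulVec, dotProduct, Q3u, ← Finset.mul_sum]
  rw [Fintype.sum_prod_type]
  simp only [Fintype.sum_prod_type]
  rw [fin3_sum p]
  unfold tau
  ring

lemma theta_sum {m : ℕ} (f : EE m → ℝ) (p : Fin 3) :
    ∑ e : EE m, (if p = e.1 then 1 else 0) * f e = tau f p := by
  rw [Fintype.sum_prod_type, Finset.sum_eq_single p]
  · simp [tau, Fintype.sum_prod_type]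
  · intro q _ hq
    simp [hq.symm]
  · simp

lemma all_sum {m : ℕ} (f : EE m → ℝ) (p : Fin 3) :
    ∑ e : EE m, f e = tau f p + tau f (p + 1) + tau f (p + 2) := by
  rw [Fintype.sum_prod_type]
  simp only [Fintype.sum_prod_type]
  rw [fin3_sum p]
  rfl

lemma Q3d_apply {m : ℕ} (f : EE m → ℝ) (p : Fin 3) (a b : Fin m) :
    (Q3d m *ᵥ f) (p, a, b) =
      (tau f p - (tau f p + tau f (p + 1) + tau f (p + 2)) / 3) / (m : ℝ) ^ 2 := by
  simp only [Matrix.mulVec, dotProduct, Q3d]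
  have : ∀ e : EE m, ((if p = e.1 then 1 else 0) - 1 / 3) / (m : ℝ) ^ 2 * f e =
      (1 / (m : ℝ) ^ 2) * ((if p = e.1 then 1 else 0) * f e) - (1 / (3 * (m : ℝ) ^ 2)) * f e := by
    intro e; ring
  rw [Finset.sum_congr rfl (fun e _ => this e), Finset.sum_sub_distrib, ← Finset.mul_sum,
    ← Finset.mul_sum, theta_sum, all_sum f p]
  ring

noncomputable def uu {m : ℕ} (f : EE m → ℝ) (p : Fin 3) (a : Fin m) : ℝ :=
  (∑ c, f (p + 2, c, a) + ∑ c, f (p, a, c) - (tau f p + tau f (p + 2)) / m) / (2 * m)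

lemma Q2u_apply {m : ℕ} (f : EE m → ℝ) (p : Fin 3) (a b : Fin m) :
    (Q2u m *ᵥ f) (p, a, b) = uu f p a + uu f (p + 1) b := by
  have hm' : (m : ℝ) ≠ 0 := by
    have := a.pos
    positivity
  have h0 : (Q2u m *ᵥ f) (p, a, b) =
      ∑ e, ((YY m * (YY m)ᵀ) (p, a, b) e - (1 + (if p = e.1 then 1 else 0)) / (m : ℝ))
        / (2 * (m : ℝ)) * f e := rfl
  have : ∀ e : EE m, ((YY m * (YY m)ᵀ) (p, a, b) e - (1 + (if p = e.1 then 1 else 0)) / (m : ℝ))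
        / (2 * (m : ℝ)) * f e =
      (1 / (2 * (m : ℝ))) * ((YY m * (YY m)ᵀ) (p, a, b) e * f e)
       - (1 / ((m : ℝ) * (2 * m))) * f e
       - (1 / ((m : ℝ) * (2 * m))) * ((if p = e.1 then 1 else 0) * f e) := by
    intro e; field_simp; ring
  rw [h0, Finset.sum_congr rfl (fun e _ => this e), Finset.sum_sub_distrib, Finset.sum_sub_distrib,
    ← Finset.mul_sum, ← Finset.mul_sum, ← Finset.mul_sum, theta_sum, all_sum f p]
  have h1 : ∑ e, (YY m * (YY m)ᵀ) (p, a, b) e * f e = ((YY m * (YY m)ᵀ) *ᵥ f) (p, a, b) := rfl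
  rw [h1, ← Matrix.mulVec_mulVec, Y_mulVec, YT_mulVec, YT_mulVec]
  simp only [uu, fin3_b]
  field_simp
  ring

lemma uu_sum {m : ℕ} (hm : 1 ≤ m) (f : EE m → ℝ) (p : Fin 3) : ∑ a, uu f p a = 0 := by
  have hm' : (m : ℝ) ≠ 0 := by positivity
  simp only [uu, ← Finset.sum_div, Finset.sum_sub_distrib, Finset.sum_add_distrib, tau_swap]
  simp only [Finset.sum_const, Finset.card_univ, Fintype.card_fin, nsmul_eq_mul]
  have : ∑ x, ∑ c, f (p, x, c) = tau f p := rfl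
  rw [this]
  field_simp
  ring

lemma Q3u_i {m : ℕ} (hm : 1 ≤ m) (f : EE m → ℝ) :
    ((dd m)ᵀ * dd m) *ᵥ (Q3u m *ᵥ f) = (3 * (m : ℝ)) • (Q3u m *ᵥ f) := by
  have hm' : (m : ℝ) ≠ 0 := by positivity
  ext ⟨p, a, b⟩
  rw [Lu_apply]
  simp only [Q3u_apply, fin3_a, fin3_b, fin3_c, fin3_d, Pi.smul_apply, smul_eq_mul,
    Finset.sum_const, Finset.card_univ, Fintype.card_fin, nsmul_eq_mul]
  ring

lemma Q2u_i {m : ℕ} (hm : 1 ≤ m) (f : EE m → ℝ) :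
    ((dd m)ᵀ * dd m) *ᵥ (Q2u m *ᵥ f) = (2 * (m : ℝ)) • (Q2u m *ᵥ f) := by
  ext ⟨p, a, b⟩
  rw [Lu_apply]
  simp only [Q2u_apply, fin3_a, fin3_b, fin3_c, fin3_d, Pi.smul_apply, smul_eq_mul,
    Finset.sum_const, Finset.card_univ, Fintype.card_fin, nsmul_eq_mul, Finset.sum_add_distrib,
    uu_sum hm]
  ring

lemma Q3d_i {m : ℕ} (hm : 1 ≤ m) (f : EE m → ℝ) :
    (d1 m * (d1 m)ᵀ) *ᵥ (Q3d m *ᵥ f) = (3 * (m : ℝ)) • (Q3d m *ᵥ f) := by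
  have hm' : (m : ℝ) ≠ 0 := by positivity
  ext ⟨p, a, b⟩
  rw [← Matrix.mulVec_mulVec, d1_mulVec, d1T_mulVec, d1T_mulVec]
  simp only [Q3d_apply, fin3_a, fin3_b, fin3_c, fin3_d, Pi.smul_apply, smul_eq_mul,
    Finset.sum_const, Finset.card_univ, Fintype.card_fin, nsmul_eq_mul]
  ring

lemma Lu_sums {m : ℕ} (f : EE m → ℝ) (μ : ℝ)
    (h : ((dd m)ᵀ * dd m) *ᵥ f = μ • f) :
    (∀ p a b, (μ - m) * f (p, a, b) = ∑ c, f (p + 1, b, c) + ∑ c, f (p + 2, c, a)) ∧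
    (∀ p a, (μ - m) * ∑ b, f (p, a, b) = tau f (p + 1) + m * ∑ c, f (p + 2, c, a)) ∧
    (∀ p a, (μ - m) * ∑ c, f (p + 2, c, a) = m * ∑ b, f (p, a, b) + tau f (p + 1)) ∧
    (∀ p, (μ - m) * tau f p = m * tau f (p + 1) + m * tau f (p + 2)) := by
  have h0 : ∀ p a b, (μ - m) * f (p, a, b) = ∑ c, f (p + 1, b, c) + ∑ c, f (p + 2, c, a) := by
    intro p a b
    have := congrFun h (p, a, b)
    rw [Lu_apply] at this
    simp only [Pi.smul_apply, smul_eq_mul] at this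
    linarith
  have h1 : ∀ p a, (μ - m) * ∑ b, f (p, a, b) = tau f (p + 1) + m * ∑ c, f (p + 2, c, a) := by
    intro p a
    rw [Finset.mul_sum]
    simp only [h0, Finset.sum_add_distrib]
    simp [tau]
  refine ⟨h0, h1, ?_, ?_⟩
  · intro p a
    rw [Finset.mul_sum]
    simp only [h0, Finset.sum_add_distrib, fin3_c, fin3_d, tau_swap]
    simp
  · intro p
    have : (μ - m) * tau f p = ∑ a, (μ - m) * ∑ b, f (p, a, b) := by
      rw [tau, Finset.mul_sum]
    rw [this]
    simp only [h1, Finset.sum_add_distrib, ← Finset.mul_sum, tau_swap]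
    simp

lemma Q3u_ii {m : ℕ} (hm : 1 ≤ m) (f : EE m → ℝ)
    (h : ((dd m)ᵀ * dd m) *ᵥ f = (3 * (m : ℝ)) • f) : Q3u m *ᵥ f = f := by
  have hm' : (m : ℝ) ≠ 0 := by positivity
  obtain ⟨h0, h1, h2, h3⟩ := Lu_sums f _ h
  ext ⟨p, a, b⟩
  rw [Q3u_apply]
  have e0 := h0 p a b
  have e1 := h1 p a
  have e2 := h2 p a
  have e3 := h1 (p + 1) b
  have e4 := h2 (p + 1) b
  have t0 := h3 p
  have t1 := h3 (p + 1)
  have t2 := h3 (p + 2)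
  simp only [fin3_a, fin3_b, fin3_c, fin3_d] at *
  have s0 : 2 * tau f p = tau f (p + 1) + tau f (p + 2) :=
    mul_left_cancel₀ hm' (by linear_combination t0)
  have s1 : 2 * tau f (p + 1) = tau f (p + 2) + tau f p :=
    mul_left_cancel₀ hm' (by linear_combination t1)
  have k1 : tau f (p + 1) = tau f p := by linarith
  have k2 : tau f (p + 2) = tau f p := by linarith
  rw [k1, k2] at *
  have r1 : m * ∑ c, f (p + 2, c, a) = tau f p := by linarith
  have r2 : m * ∑ c, f (p + 1, b, c) = tau f p := by linarith
  rw [div_eq_iff (by positivity)]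
  linear_combination (-3/2 * (m : ℝ)) * e0 - (3/2 : ℝ) * r1 - (3/2 : ℝ) * r2

lemma Q2u_ii {m : ℕ} (hm : 1 ≤ m) (f : EE m → ℝ)
    (h : ((dd m)ᵀ * dd m) *ᵥ f = (2 * (m : ℝ)) • f) : Q2u m *ᵥ f = f := by
  have hm' : (m : ℝ) ≠ 0 := by positivity
  obtain ⟨h0, h1, h2, h3⟩ := Lu_sums f _ h
  ext ⟨p, a, b⟩
  rw [Q2u_apply]
  have tz : ∀ p a, tau f (p + 1) = 0 ∧ ∑ c, f (p + 2, c, a) = ∑ b, f (p, a, b) := by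
    intro p a
    have e1 := h1 p a
    have e2 := h2 p a
    have : tau f (p + 1) = 0 := by linarith
    refine ⟨this, mul_left_cancel₀ hm' ?_⟩
    linarith
  have a0 := (tz (p + 2) a).1
  have a1 := tz p a
  have a2 := tz (p + 1) b
  have e0 := h0 p a b
  simp only [uu, fin3_a, fin3_b, fin3_c, fin3_d] at *
  rw [a2.1, a1.1, a0, a2.2]
  rw [a1.2] at e0 ⊢
  field_simp
  linear_combination (-2 * (m : ℝ)) * e0

lemma Q3d_ii {m : ℕ} (hm : 1 ≤ m) (f : EE m → ℝ)
    (h : (d1 m * (d1 m)ᵀ) *ᵥ f = (3 * (m : ℝ)) • f) : Q3d m *ᵥ f = f := by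
  have hm' : (m : ℝ) ≠ 0 := by positivity
  obtain ⟨g, hg⟩ : ∃ g : Fin 3 → Fin m → ℝ, ∀ p a, g p a =
    ∑ c, f (p + 2, c, a) - ∑ c, f (p, a, c) := ⟨_, fun _ _ => rfl⟩
  have h0 : ∀ p a b, 3 * m * f (p, a, b) = g (p + 1) b - g p a := by
    intro p a b
    have := congrFun h (p, a, b)
    rw [← Matrix.mulVec_mulVec, d1_mulVec, d1T_mulVec, d1T_mulVec, ← hg, ← hg] at this
    simp only [Pi.smul_apply, smul_eq_mul] at this
    linarith
  have h1 : ∀ p a, 3 * m * ∑ b, f (p, a, b) = ∑ b, g (p + 1) b - m * g p a := by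
    intro p a
    rw [Finset.mul_sum]
    simp only [h0, Finset.sum_sub_distrib]
    simp
  have h2 : ∀ p a, 3 * m * ∑ c, f (p + 2, c, a) = m * g p a - ∑ b, g (p + 2) b := by
    intro p a
    rw [Finset.mul_sum]
    simp only [h0, Finset.sum_sub_distrib, fin3_c]
    simp
  have h3 : ∀ p a, m * g p a = - ∑ b, g (p + 1) b - ∑ b, g (p + 2) b := by
    intro p a
    linear_combination h2 p a - h1 p a + (3 * (m : ℝ)) * hg p a
  have h4 : ∀ p a b, f (p, a, b) =
      (∑ b, g (p + 1) b - ∑ b, g p b) / (3 * m * m) := by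
    intro p a b
    rw [eq_div_iff (by positivity)]
    have k1 := h3 p a
    have k2 := h3 (p + 1) b
    simp only [fin3_a, fin3_b] at k2
    linear_combination (m : ℝ) * h0 p a b + k2 - k1
  ext ⟨p, a, b⟩
  rw [Q3d_apply]
  simp only [tau]
  simp only [h4, fin3_a, fin3_b, fin3_c, fin3_d, 
    Finset.sum_const, Finset.card_univ, Fintype.card_fin, nsmul_eq_mul]
  field_simp
  ring

lemma transfer {ι κ : Type} [Fintype ι] [Fintype κ] [DecidableEq ι] [DecidableEq κ]
    (Φ : Matrix ι κ ℝ) (hΦ : Φᵀ * Φ = 1) (L Q : Matrix κ κ ℝ) (μ : ℝ) (hμ : μ ≠ 0)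
    (hQ : Qᵀ = Q) (h1 : ∀ f, L *ᵥ (Q *ᵥ f) = μ • (Q *ᵥ f)) (h2 : ∀ f, L *ᵥ f = μ • f → Q *ᵥ f = f)
    (P : Matrix ι ι ℝ) (hP : Pᵀ = P ∧ P * P = P ∧
      LinearMap.range (Matrix.mulVecLin P) =
        Module.End.eigenspace (Matrix.mulVecLin (Φ * L * Φᵀ)) μ) : P = Φ * Q * Φᵀ := by
  obtain ⟨hPt, hPP, hr⟩ := hP
  have hmem : ∀ x, x ∈ LinearMap.range (Matrix.mulVecLin P) ↔ (Φ * L * Φᵀ) *ᵥ x = μ • x := by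
    intro x
    rw [hr, Module.End.mem_eigenspace_iff]
    rfl
  have hPQ : P * (Φ * Q * Φᵀ) = Φ * Q * Φᵀ := by
    apply Matrix.ext_of_mulVec_single
    intro i
    generalize (Pi.single i (1 : ℝ) : ι → ℝ) = x
    have : (Φ * Q * Φᵀ) *ᵥ x ∈ LinearMap.range (Matrix.mulVecLin P) := by
      rw [hmem]
      have e : (Φ * L * Φᵀ) *ᵥ ((Φ * Q * Φᵀ) *ᵥ x) = Φ *ᵥ (L *ᵥ (Q *ᵥ (Φᵀ *ᵥ x))) := by
        simp only [Matrix.mulVec_mulVec]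
        congr 1
        calc _ = Φ * L * (Φᵀ * Φ) * Q * Φᵀ := by simp only [Matrix.mul_assoc]
          _ = _ := by rw [hΦ, Matrix.mul_one]; simp only [Matrix.mul_assoc]
      rw [e, h1, Matrix.mulVec_smul]
      simp only [Matrix.mulVec_mulVec, Matrix.mul_assoc]
    obtain ⟨y, hy⟩ := this
    rw [← Matrix.mulVec_mulVec, ← hy]
    simp only [Matrix.mulVecLin_apply, Matrix.mulVec_mulVec, hPP]
  have hQP : (Φ * Q * Φᵀ) * P = P := by
    apply Matrix.ext_of_mulVec_single
    intro i
    generalize (Pi.single i (1 : ℝ) : ι → ℝ) = x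
    have : P *ᵥ x ∈ LinearMap.range (Matrix.mulVecLin P) := ⟨x, rfl⟩
    rw [hmem] at this
    rw [← Matrix.mulVec_mulVec]
    generalize P *ᵥ x = z at this
    set y := Φᵀ *ᵥ z with hy
    have e1 : L *ᵥ y = μ • y := by
      rw [hy, ← Matrix.mulVec_smul, ← this]
      simp only [Matrix.mulVec_mulVec]
      congr 1
      calc _ = (1 : Matrix κ κ ℝ) * L * Φᵀ := by rw [Matrix.one_mul]
        _ = _ := by rw [← hΦ]; simp only [Matrix.mul_assoc]
    have e2 : z = Φ *ᵥ y := by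
      have : μ • z = μ • (Φ *ᵥ y) := by
        rw [← this, ← Matrix.mulVec_smul, ← e1, hy]
        simp only [Matrix.mulVec_mulVec, Matrix.mul_assoc]
      exact smul_right_injective _ hμ this
    have e3 := h2 y e1
    calc (Φ * Q * Φᵀ) *ᵥ z = Φ *ᵥ (Q *ᵥ y) := by
          rw [hy]; simp only [Matrix.mulVec_mulVec, Matrix.mul_assoc]
      _ = z := by rw [e3, ← e2]
  have := congrArg Matrix.transpose hPQ
  rw [Matrix.transpose_mul, hPt] at this
  simp only [Matrix.transpose_mul, Matrix.transpose_transpose, hQ] at this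
  rw [← Matrix.mul_assoc, hQP] at this
  exact this

lemma Q2u_symm (m : ℕ) : (Q2u m)ᵀ = Q2u m := by
  have h : (YY m * (YY m)ᵀ)ᵀ = YY m * (YY m)ᵀ := by simp
  ext e e'
  have := congrFun (congrFun h e) e'
  simp only [transpose_apply] at this
  simp only [transpose_apply, Q2u, this, eq_comm]

lemma Q3d_symm (m : ℕ) : (Q3d m)ᵀ = Q3d m := by
  ext e e'
  simp only [transpose_apply, Q3d, eq_comm]

lemma Q3u_symm (m : ℕ) : (Q3u m)ᵀ = Q3u m := rfl

lemma T_same {m : ℕ} (hm : 1 ≤ m) (p : Fin 3) (a b a' b' : Fin m) :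
    ((2 * (m : ℝ)) • (Q3u m + Q2u m + Q3d m) - d1 m * (d1 m)ᵀ) (p, a, b) (p, a', b') = 0 := by
  have hm' : (m : ℝ) ≠ 0 := by positivity
  have h1 : (YY m * (YY m)ᵀ) (p, a, b) (p, a', b') =
      (d1 m * (d1 m)ᵀ) (p, a, b) (p, a', b') := by
    simp only [Matrix.mul_apply, transpose_apply, YY, d1]
    simp [add_mul, sub_mul, Finset.sum_add_distrib, Finset.sum_sub_distrib, vx_inj, fin3_f,
      (fin3_f p).symm]
  simp only [Matrix.sub_apply, Matrix.smul_apply, Matrix.add_apply, Q3u, Q2u, Q3d, h1, smul_eq_mul,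
    if_true]
  field_simp
  ring

lemma d1T_d1 {m : ℕ} : (d1 m)ᵀ * d1 m =
    (2 * (m : ℝ)) • 1 - Matrix.of (fun _ _ => 1) + GG m * (GG m)ᵀ := by
  apply Matrix.ext_of_mulVec_single
  intro i
  ext v
  obtain ⟨p, a, rfl⟩ := vx_surj v
  obtain ⟨q, b, rfl⟩ := vx_surj i
  rw [← Matrix.mulVec_mulVec, d1T_mulVec]
  simp only [d1_mulVec, fin3_c]
  simp only [Pi.single_apply, vx_inj, ite_and, Finset.sum_sub_distrib, Matrix.mulVec_single_one,
    Matrix.col_apply, Matrix.add_apply, Matrix.sub_apply, Matrix.smul_apply, Matrix.one_apply,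
    Matrix.mul_apply, transpose_apply, GG, vx_part, Matrix.of_apply]
  fin_cases p <;> fin_cases q <;> simp [Fin.sum_univ_three] <;> split_ifs <;> ring

lemma Q3d_d1 {m : ℕ} (hm : 1 ≤ m) : ∃ A : Matrix (EE m) (Fin 3) ℝ, Q3d m * d1 m = A * (GG m)ᵀ := by
  refine ⟨Matrix.of fun e r => ((if r = e.1 + 1 then 1 else 0) - (if r = e.1 then 1 else 0)) / m, ?_⟩
  apply Matrix.ext_of_mulVec_single
  intro i
  ext ⟨p, a, b⟩
  obtain ⟨q, c, rfl⟩ := vx_surj i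
  have hm' : (m : ℝ) ≠ 0 := by positivity
  rw [← Matrix.mulVec_mulVec, Q3d_apply]
  simp only [tau, d1_mulVec]
  simp only [Pi.single_apply, vx_inj, ite_and, Finset.sum_sub_distrib, Matrix.mulVec_single_one,
    Matrix.col_apply, Matrix.mul_apply, transpose_apply, GG, vx_part, Matrix.of_apply]
  fin_cases p <;> fin_cases q <;> simp [Fin.sum_univ_three] <;> field_simp

lemma psd_abstract {ι : Type} [Fintype ι] [DecidableEq ι] (m : ℝ) (hm : 0 < m)
    (J S C K : Matrix ι ι ℝ) (hJt : Jᵀ = J) (hJJ : J * J = J) (hSt : Sᵀ = S) (hSS : S * S = S)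
    (hJS : J * S = S) (hSJ : S * J = S) (hSC : S * C = 0) (hJC : J * C = C) (hKt : Kᵀ = K)
    (hCC : Cᵀ * C = (2 * m) • K) (hKK : K * K = m • K) (hJK : J * K = 0) (hKJ : K * J = 0) :
    ((2 * m) • (1 : Matrix ι ι ℝ) - (2 * m) • S - C - Cᵀ - K).PosSemidef := by
  have hCJ : Cᵀ * J = Cᵀ := by
    have := congrArg Matrix.transpose hJC
    rwa [Matrix.transpose_mul, hJt] at this
  have hCS : Cᵀ * S = 0 := by
    have := congrArg Matrix.transpose hSC
    rwa [Matrix.transpose_mul, hSt, Matrix.transpose_zero] at this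
  have e : (2 * m) • (1 : Matrix ι ι ℝ) - (2 * m) • S - C - Cᵀ - K =
      (2 * m) • ((J - S - (2 * m)⁻¹ • C)ᴴ * (J - S - (2 * m)⁻¹ • C)) +
      (2 / m) • ((m • (1 - J) - K)ᴴ * (m • (1 - J) - K)) := by
    simp only [Matrix.conjTranspose_eq_transpose_of_trivial, Matrix.transpose_sub,
      Matrix.transpose_smul, Matrix.transpose_one, hJt, hSt, hKt]
    simp only [Matrix.sub_mul, Matrix.mul_sub, Matrix.smul_mul, Matrix.mul_smul, hJJ, hSS, hJS, hSJ,
      hSC, hJC, hCJ, hCS, hCC, hKK, hJK, hKJ, Matrix.one_mul, Matrix.mul_one]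
    ext i j
    simp only [Matrix.sub_apply, Matrix.add_apply, Matrix.smul_apply, smul_eq_mul, Matrix.zero_apply]
    field_simp
    ring
  rw [e]
  exact ((Matrix.posSemidef_conjTranspose_mul_self _).smul (by positivity)).add
    ((Matrix.posSemidef_conjTranspose_mul_self _).smul (by positivity))

lemma union_mem {m : ℕ} (e e' : EE m) (hne : e.1 ≠ e'.1) (h : (edge e ∩ edge e').Nonempty) :
    edge e ∪ edge e' ∈ (tripartite m).dfaces 3 := by
  rw [dfaces_three, mem_image]
  obtain ⟨p, a, b⟩ := e
  obtain ⟨q, c, d⟩ := e'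
  obtain ⟨v, hv⟩ := h
  simp only [edge, mem_inter, mem_insert, mem_singleton] at hv
  obtain ⟨h1, h2⟩ := hv
  have key : (q = p + 1 ∧ b = c) ∨ (p = q + 1 ∧ d = a) := by
    rcases h1 with h1 | h1 <;> rcases h2 with h2 | h2 <;> rw [h1, vx_inj] at h2
    · exact absurd h2.1 hne
    · exact Or.inr ⟨h2.1, h2.2.symm⟩
    · exact Or.inl ⟨h2.1.symm, h2.2⟩
    · exact absurd (add_right_cancel h2.1) hne
  have main : ∀ (p : Fin 3) (a b c : Fin m), ∃ t, tri t = edge (p, a, b) ∪ edge (p + 1, b, c) := by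
    intro p a b c
    fin_cases p
    · exact ⟨(a, b, c), by ext; simp [tri, edge]⟩
    · exact ⟨(c, a, b), by ext; simp [tri, edge]; tauto⟩
    · exact ⟨(b, c, a), by ext; simp [tri, edge]; tauto⟩
  rcases key with ⟨rfl, rfl⟩ | ⟨rfl, rfl⟩
  · obtain ⟨t, ht⟩ := main p a b d
    exact ⟨t, mem_univ _, ht⟩
  · obtain ⟨t, ht⟩ := main q c d b
    exact ⟨t, mem_univ _, by rw [ht, Finset.union_comm]⟩

lemma eig_mul {ι : Type} [Fintype ι] [DecidableEq ι] (L P : Matrix ι ι ℝ) (μ : ℝ)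
    (hr : LinearMap.range (Matrix.mulVecLin P) = Module.End.eigenspace (Matrix.mulVecLin L) μ) :
    L * P = μ • P := by
  apply Matrix.ext_of_mulVec_single
  intro i
  generalize (Pi.single i (1 : ℝ) : ι → ℝ) = x
  have : P *ᵥ x ∈ LinearMap.range (Matrix.mulVecLin P) := ⟨x, rfl⟩
  rw [hr, Module.End.mem_eigenspace_iff] at this
  rw [← Matrix.mulVec_mulVec, Matrix.smul_mulVec]
  exact this

lemma mul_eig {ι : Type} [Fintype ι] [DecidableEq ι] (L P : Matrix ι ι ℝ) (μ : ℝ)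
    (hL : Lᵀ = L) (hP : Pᵀ = P) (h : L * P = μ • P) : P * L = μ • P := by
  have := congrArg Matrix.transpose h
  rwa [Matrix.transpose_mul, Matrix.transpose_smul, hL, hP] at this

lemma orth {ι : Type} [Fintype ι] (P R : Matrix ι ι ℝ) (hP : Pᵀ = P) (hR : Rᵀ = R)
    (h : P * R = 0) : R * P = 0 := by
  have := congrArg Matrix.transpose h
  rwa [Matrix.transpose_mul, hP, hR, Matrix.transpose_zero] at this

lemma smul_zero_cancel {ι κ : Type} {M : Matrix ι κ ℝ} {c : ℝ} (hc : c ≠ 0) (h : c • M = 0) :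
    M = 0 := (smul_eq_zero.1 h).resolve_left hc

end helpers

/-- For `X = K²_{m,m,m}`, let `P↑_{3m}`, `P↑_{2m}` be the orthogonal
projections onto the eigenspaces of `L↑_1(X)` for the eigenvalues `3m` and `2m`, and
`P↓_{3m}` the orthogonal projection onto the `3m`-eigenspace of `L↓_1(X)` (all matrices
indexed by all 2-subsets of `V`, the Laplacians of `X` being extended by zero). Then
`T = 2m(P↑_{3m} + P↑_{2m} + P↓_{3m}) − L↓_1(X)` has zero diagonal, vanishes at pairs
`(F,F')` with `F ∩ F' ≠ ∅` and `F ∪ F' ∉ X_2`, and `2m·I − L↓_1 − T ⪰ 0`, where `L↓_1`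
is the down-Laplacian of the complete 2-complex. -/
theorem tripartite_dual_certificate
    (m : ℕ) (hm : 1 ≤ m)
    (P3u P2u P3d : Matrix (KSet (Fin (3 * m)) 2) (KSet (Fin (3 * m)) 2) ℝ)
    (hP3u : P3uᵀ = P3u ∧ P3u * P3u = P3u ∧
      LinearMap.range (Matrix.mulVecLin P3u) =
        Module.End.eigenspace (Matrix.mulVecLin (LupE (tripartite m) 2)) (3 * (m : ℝ)))
    (hP2u : P2uᵀ = P2u ∧ P2u * P2u = P2u ∧
      LinearMap.range (Matrix.mulVecLin P2u) =
        Module.End.eigenspace (Matrix.mulVecLin (LupE (tripartite m) 2)) (2 * (m : ℝ)))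
    (hP3d : P3dᵀ = P3d ∧ P3d * P3d = P3d ∧
      LinearMap.range (Matrix.mulVecLin P3d) =
        Module.End.eigenspace (Matrix.mulVecLin (LdownE (tripartite m) 2)) (3 * (m : ℝ)))
    (T : Matrix (KSet (Fin (3 * m)) 2) (KSet (Fin (3 * m)) 2) ℝ)
    (hT : T = (2 * (m : ℝ)) • (P3u + P2u + P3d) - LdownE (tripartite m) 2) :
    (∀ F, T F F = 0) ∧
    (∀ F F' : KSet (Fin (3 * m)) 2, (F.1 ∩ F'.1).Nonempty →
      F.1 ∪ F'.1 ∉ (tripartite m).dfaces 3 → T F F' = 0) ∧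
    ((2 * (m : ℝ)) • (1 : Matrix (KSet (Fin (3 * m)) 2) (KSet (Fin (3 * m)) 2) ℝ) -
      Lc (Fin (3 * m)) 2 - T).PosSemidef := by
  have hmR : (0 : ℝ) < m := by exact_mod_cast hm
  have e3u := hP3u
  have e2u := hP2u
  have e3d := hP3d
  rw [LupE_eq] at e3u e2u
  rw [LdownE_eq] at e3d
  have q3u := transfer _ (PhiT_Phi m) _ _ _ (by positivity) (Q3u_symm m) (Q3u_i hm) (Q3u_ii hm) _ e3u
  have q2u := transfer _ (PhiT_Phi m) _ _ _ (by positivity) (Q2u_symm m) (Q2u_i hm) (Q2u_ii hm) _ e2u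
  have q3d := transfer _ (PhiT_Phi m) _ _ _ (by positivity) (Q3d_symm m) (Q3d_i hm) (Q3d_ii hm) _ e3d
  have hT' : T = Phi m * ((2 * (m : ℝ)) • (Q3u m + Q2u m + Q3d m) - d1 m * (d1 m)ᵀ) * (Phi m)ᵀ := by
    rw [hT, q3u, q2u, q3d, LdownE_eq]
    simp only [Matrix.mul_sub, Matrix.sub_mul, Matrix.mul_smul, Matrix.smul_mul, Matrix.mul_add,
      Matrix.add_mul]
  have hTne : ∀ F F', T F F' ≠ 0 → ∃ e e' : EE m, F.1 = edge e ∧ F'.1 = edge e' ∧ e.1 ≠ e'.1 := by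
    intro F F' hne
    by_contra hcon
    push Not at hcon
    apply hne
    rw [hT', Matrix.mul_apply]
    apply Finset.sum_eq_zero
    intro e' _
    rw [Matrix.mul_apply, Finset.sum_mul]
    apply Finset.sum_eq_zero
    intro e _
    by_cases h1 : F.1 = edge e
    · by_cases h2 : F'.1 = edge e'
      · have h3 := hcon e e' h1 h2
        obtain ⟨p, a, b⟩ := e
        obtain ⟨p', a', b'⟩ := e'
        simp only at h3
        subst h3
        rw [T_same hm]; simp
      · simp [Phi, h2]
    · simp [Phi, h1]
  refine ⟨?_, ?_, ?_⟩
  · intro F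
    by_contra hne
    obtain ⟨e, e', h1, h2, h3⟩ := hTne F F hne
    exact h3 (by rw [edge_inj (h1.symm.trans h2)])
  · intro F F' hi hu
    by_contra hne
    obtain ⟨e, e', h1, h2, h3⟩ := hTne F F' hne
    rw [h1, h2] at hi hu
    exact hu (union_mem e e' h3 hi)
  · -- the semidefinite part
    obtain ⟨t3u, i3u, r3u⟩ := hP3u
    obtain ⟨t2u, i2u, r2u⟩ := hP2u
    obtain ⟨t3d, i3d, r3d⟩ := hP3d
    set Lu := LupE (tripartite m) 2 with hLu
    set Ld := LdownE (tripartite m) 2 with hLd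
    set J := Phi m * (Phi m)ᵀ with hJ
    have Lut : Luᵀ = Lu := by
      rw [hLu, LupE_eq]
      simp only [Matrix.transpose_mul, Matrix.transpose_transpose, Matrix.mul_assoc]
    have Ldt : Ldᵀ = Ld := by
      rw [hLd, LdownE_eq]
      simp only [Matrix.transpose_mul, Matrix.transpose_transpose, Matrix.mul_assoc]
    have Jt : Jᵀ = J := by
      rw [hJ]; simp only [Matrix.transpose_mul, Matrix.transpose_transpose]
    have JPhi : J * Phi m = Phi m := by rw [hJ, Matrix.mul_assoc, PhiT_Phi, Matrix.mul_one]
    have PhiJ : (Phi m)ᵀ * J = (Phi m)ᵀ := by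
      rw [hJ, ← Matrix.mul_assoc, PhiT_Phi, Matrix.one_mul]
    have JJ : J * J = J := by
      conv_lhs => rw [hJ, Matrix.mul_assoc, PhiJ]
    have JD : J * DD m = Phi m * d1 m := by rw [hJ, Matrix.mul_assoc, PhiT_D]
    have LuJD : Lu * (J * DD m) = 0 := by
      rw [JD, hLu, LupE_eq]
      calc _ = Phi m * (dd m)ᵀ * (dd m * (((Phi m)ᵀ * Phi m) * d1 m)) := by
            simp only [Matrix.mul_assoc]
        _ = 0 := by rw [PhiT_Phi, Matrix.one_mul, dd_d1, Matrix.mul_zero]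
    have LuLd : Lu * Ld = 0 := by
      have : Ld = (J * DD m) * ((DD m)ᵀ * J) := by
        rw [hLd, LdownE_eq', ← hJ]; simp only [Matrix.mul_assoc]
      rw [this, ← Matrix.mul_assoc, LuJD, Matrix.zero_mul]
    have l3u := eig_mul _ _ _ r3u
    have l2u := eig_mul _ _ _ r2u
    have l3d := eig_mul _ _ _ r3d
    have l3u' := mul_eig _ _ _ Lut t3u l3u
    have l2u' := mul_eig _ _ _ Lut t2u l2u
    have n3 : (3 * (m : ℝ)) ≠ 0 := by positivity
    have n2 : (2 * (m : ℝ)) ≠ 0 := by positivity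
    have o1 : P3u * P2u = 0 := by
      have h1 : P3u * Lu * P2u = (3 * (m : ℝ)) • (P3u * P2u) := by rw [l3u', Matrix.smul_mul]
      have h2 : P3u * Lu * P2u = (2 * (m : ℝ)) • (P3u * P2u) := by
        rw [Matrix.mul_assoc, l2u, Matrix.mul_smul]
      have h3 : (m : ℝ) • (P3u * P2u) = 0 := by
        have : (m : ℝ) = 3 * m - 2 * m := by ring
        rw [this, sub_smul, ← h1, ← h2, sub_self]
      exact smul_zero_cancel hmR.ne' h3
    have LuP3d : Lu * P3d = 0 := by
      apply smul_zero_cancel n3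
      rw [← Matrix.mul_smul, ← l3d, ← Matrix.mul_assoc, LuLd, Matrix.zero_mul]
    have o2 : P3u * P3d = 0 := by
      apply smul_zero_cancel n3
      rw [← Matrix.smul_mul, ← l3u', Matrix.mul_assoc, LuP3d, Matrix.mul_zero]
    have o3 : P2u * P3d = 0 := by
      apply smul_zero_cancel n2
      rw [← Matrix.smul_mul, ← l2u', Matrix.mul_assoc, LuP3d, Matrix.mul_zero]
    have o1' := orth _ _ t3u t2u o1
    have o2' := orth _ _ t3u t3d o2
    have o3' := orth _ _ t2u t3d o3
    set S := P3u + P2u + P3d with hS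
    have St : Sᵀ = S := by rw [hS]; simp only [Matrix.transpose_add, t3u, t2u, t3d]
    have SS : S * S = S := by
      rw [hS]
      simp only [Matrix.add_mul, Matrix.mul_add, i3u, i2u, i3d, o1, o2, o3, o1', o2', o3']
      simp
    have SPhi : S = Phi m * ((Q3u m + Q2u m + Q3d m) * (Phi m)ᵀ) := by
      rw [hS, q3u, q2u, q3d]
      simp only [Matrix.mul_add, Matrix.add_mul, Matrix.mul_assoc]
    have JS : J * S = S := by
      rw [SPhi, ← Matrix.mul_assoc, JPhi]
    have SJ : S * J = S := by
      have := congrArg Matrix.transpose JS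
      rwa [Matrix.transpose_mul, St, Jt] at this
    have GD : (GG m)ᵀ * ((DD m)ᵀ * (1 - J)) = 0 := by
      have := congrArg Matrix.transpose (innerDG m)
      rw [Matrix.transpose_mul, Matrix.transpose_mul, Matrix.transpose_sub, Matrix.transpose_one,
        ← hJ, Jt, Matrix.transpose_zero, Matrix.mul_assoc] at this
      exact this
    have OD : (Matrix.of (fun _ _ => 1) : Matrix (Fin (3 * m)) (Fin (3 * m)) ℝ) * ((DD m)ᵀ * (1 - J)) = 0 := by
      rw [← Matrix.mul_assoc]
      have : (Matrix.of (fun _ _ => 1) : Matrix (Fin (3 * m)) (Fin (3 * m)) ℝ) * (DD m)ᵀ = 0 := by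
        ext v F
        simp [Matrix.mul_apply, DD_row]
      rw [this, Matrix.zero_mul]
    have DJD : (DD m)ᵀ * (J * DD m) = (d1 m)ᵀ * d1 m := by
      rw [← PhiT_D, hJ, Matrix.transpose_mul, Matrix.transpose_transpose]
      simp only [Matrix.mul_assoc]
    have A1 : (DD m)ᵀ * (J * DD m) * ((DD m)ᵀ * (1 - J)) = (2 * (m : ℝ)) • ((DD m)ᵀ * (1 - J)) := by
      rw [DJD, d1T_d1, Matrix.add_mul, Matrix.sub_mul, OD, Matrix.mul_assoc, GD, Matrix.mul_zero,
        Matrix.smul_mul, Matrix.one_mul]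
      simp
    have A2 : (DD m)ᵀ * ((1 - J) * DD m) * ((DD m)ᵀ * (1 - J)) = (m : ℝ) • ((DD m)ᵀ * (1 - J)) := by
      rw [Matrix.sub_mul, Matrix.one_mul, Matrix.mul_sub, Matrix.sub_mul (M := (DD m)ᵀ * DD m), A1, DtD,
        Matrix.sub_mul, OD, Matrix.smul_mul, Matrix.one_mul, sub_zero, ← sub_smul]
      congr 1; ring
    have IJ : (1 - J) * (1 - J) = 1 - J := by
      rw [Matrix.sub_mul, Matrix.mul_sub, Matrix.mul_sub, JJ]; simp
    have JI : J * (1 - J) = 0 := by rw [Matrix.mul_sub, JJ]; simp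
    have IJ0 : (1 - J) * J = 0 := by rw [Matrix.sub_mul, JJ]; simp
    have It : (1 - J)ᵀ = 1 - J := by rw [Matrix.transpose_sub, Jt, Matrix.transpose_one]
    set C := J * DD m * ((DD m)ᵀ * (1 - J)) with hC
    set K := (1 - J) * DD m * ((DD m)ᵀ * (1 - J)) with hK
    have Ct : Cᵀ = (1 - J) * DD m * ((DD m)ᵀ * J) := by
      rw [hC]
      simp only [Matrix.transpose_mul, Matrix.transpose_transpose, It, Jt, Matrix.mul_assoc]
    have Kt : Kᵀ = K := by
      rw [hK]
      simp only [Matrix.transpose_mul, Matrix.transpose_transpose, It, Matrix.mul_assoc]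
    have CC : Cᵀ * C = (2 * (m : ℝ)) • K := by
      rw [Ct, hC, hK, ← Matrix.mul_smul, ← A1]
      calc _ = (1 - J) * DD m * (DD m)ᵀ * (J * J) * DD m * ((DD m)ᵀ * (1 - J)) := by
            simp only [Matrix.mul_assoc]
        _ = _ := by rw [JJ]; simp only [Matrix.mul_assoc]
    have KK : K * K = (m : ℝ) • K := by
      rw [hK, ← Matrix.mul_smul, ← A2]
      calc _ = (1 - J) * DD m * (DD m)ᵀ * ((1 - J) * (1 - J)) * DD m * ((DD m)ᵀ * (1 - J)) := by
            simp only [Matrix.mul_assoc]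
        _ = _ := by rw [IJ]; simp only [Matrix.mul_assoc]
    have JK : J * K = 0 := by
      rw [hK]; simp only [← Matrix.mul_assoc]; rw [JI]; simp only [Matrix.zero_mul]
    have KJ : K * J = 0 := by
      rw [hK]; simp only [Matrix.mul_assoc]; rw [IJ0]; simp only [Matrix.mul_zero]
    have JC : J * C = C := by
      rw [hC]; simp only [← Matrix.mul_assoc]; rw [JJ]
    have SC : S * C = 0 := by
      have hu1 : P3u * (J * DD m) = 0 := by
        apply smul_zero_cancel n3
        rw [← Matrix.smul_mul, ← l3u', Matrix.mul_assoc, LuJD, Matrix.mul_zero]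
      have hu2 : P2u * (J * DD m) = 0 := by
        apply smul_zero_cancel n2
        rw [← Matrix.smul_mul, ← l2u', Matrix.mul_assoc, LuJD, Matrix.mul_zero]
      have hd : P3d * (J * DD m) * ((DD m)ᵀ * (1 - J)) = 0 := by
        obtain ⟨A, hA⟩ := Q3d_d1 hm
        have : P3d * (J * DD m) = Phi m * (A * (GG m)ᵀ) := by
          rw [JD, q3d, ← hA]
          calc _ = Phi m * Q3d m * (((Phi m)ᵀ * Phi m) * d1 m) := by simp only [Matrix.mul_assoc]
            _ = _ := by rw [PhiT_Phi, Matrix.one_mul, Matrix.mul_assoc]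
        rw [this, Matrix.mul_assoc, Matrix.mul_assoc, GD, Matrix.mul_zero, Matrix.mul_zero]
      rw [hC, hS, Matrix.add_mul, Matrix.add_mul, ← Matrix.mul_assoc P3u, ← Matrix.mul_assoc P2u,
        ← Matrix.mul_assoc P3d, hu1, hu2, hd]
      simp
    have := psd_abstract (m : ℝ) hmR J S C K Jt JJ St SS JS SJ SC JC Kt CC KK JK KJ
    have fin : (2 * (m : ℝ)) • (1 : Matrix (KSet (Fin (3 * m)) 2) (KSet (Fin (3 * m)) 2) ℝ) -
      Lc (Fin (3 * m)) 2 - T = (2 * (m : ℝ)) • 1 - (2 * (m : ℝ)) • S - C - Cᵀ - K := by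
      have hLd' : Ld = J * (DD m * (DD m)ᵀ) * J := by rw [hLd, LdownE_eq']
      rw [hT, Lc_eq, Ct, hC, hK, hLd']
      simp only [Matrix.sub_mul, Matrix.mul_sub, Matrix.one_mul, Matrix.mul_one, Matrix.mul_assoc]
      abel
    rw [fin]
    exact this
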